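/- Let ν be a positive measure on (0,∞) with ∫_{(0,∞)} (1+r)⁻¹ ν(dr) < ∞ and let A₁(ω) = ω² ∫_{(0,∞)} (ω² + r²)⁻¹ ν(dr). If there exist constants C > 0 and γ ∈ ℝ and a nonempty open interval I ⊆ (0,∞) such that A₁(ω) = C·ω^γ for all ω ∈ I, then A₁(ω) = C·ω^γ for all ω > 0. -/

import Mathlib

open MeasureTheory Filter Topology

/-- The kernel `(a + r²)⁻¹` is dominated by a multiple of `(1 + r)⁻¹` on `(0,∞)`. -/
theorem inv_add_sq_le_mul_inv_one_add {a r : ℝ} (ha : 0 < a) (hr : 0 < r) :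
    (a + r ^ 2)⁻¹ ≤ (2 / a + 1) * (1 + r)⁻¹ := by
  have h1 : 0 < a + r ^ 2 := by positivity
  have h2 : (2 / a + 1) * (a + r ^ 2) = 2 + a + 2 / a * r ^ 2 + r ^ 2 := by
    field_simp
    ring
  have h3 : 0 ≤ 2 / a * r ^ 2 := by positivity
  rw [← div_eq_mul_inv, inv_eq_one_div, div_le_div_iff₀ h1 (by positivity), h2]
  nlinarith [sq_nonneg (r - 1)]

theorem norm_inv_add_sq_le {a r : ℝ} {w : ℂ} (ha : 0 < a) (hw : a ≤ w.re) :
    ‖(w + (r : ℂ) ^ 2)⁻¹‖ ≤ (a + r ^ 2)⁻¹ := by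
  rw [norm_inv]
  have h := Complex.re_le_norm (w + (r : ℂ) ^ 2)
  have h' : (w + (r : ℂ) ^ 2).re = w.re + r ^ 2 := by
    rw [← Complex.ofReal_pow, Complex.add_re, Complex.ofReal_re]
  exact inv_anti₀ (by positivity) (by linarith)

theorem add_ofReal_sq_ne_zero {w : ℂ} (hw : 0 < w.re) (r : ℝ) : w + (r : ℂ) ^ 2 ≠ 0 := by
  intro h
  have h' := congrArg Complex.re h
  rw [← Complex.ofReal_pow, Complex.add_re, Complex.ofReal_re, Complex.zero_re] at h'
  nlinarith [sq_nonneg r]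

/-- The Stieltjes-type transform `w ↦ ∫ (w + r²)⁻¹ ν(dr)` is holomorphic on the right
half-plane. -/
theorem differentiableAt_integral_inv_add_sq {ν : Measure ℝ}
    (hν : IntegrableOn (fun r : ℝ => (1 + r)⁻¹) (Set.Ioi 0) ν) {w₀ : ℂ} (hw₀ : 0 < w₀.re) :
    DifferentiableAt ℂ (fun w : ℂ => ∫ r in Set.Ioi (0 : ℝ), (w + (r : ℂ) ^ 2)⁻¹ ∂ν) w₀ := by
  set a := w₀.re / 2 with ha_def
  have ha : 0 < a := by positivity
  have hs : {w : ℂ | a < w.re} ∈ 𝓝 w₀ :=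
    (isOpen_lt continuous_const Complex.continuous_re).mem_nhds
      (by change a < w₀.re; linarith)
  have hmeas : ∀ w : ℂ, Measurable fun r : ℝ => (w + (r : ℂ) ^ 2)⁻¹ := fun w => by fun_prop
  refine (hasDerivAt_integral_of_dominated_loc_of_deriv_le
    (F' := fun w r => -((w + (r : ℂ) ^ 2)⁻¹ * (w + (r : ℂ) ^ 2)⁻¹))
    (bound := fun r => a⁻¹ * ((2 / a + 1) * (1 + r)⁻¹)) hs
    (Eventually.of_forall fun w => (hmeas w).aestronglyMeasurable) ?_
    ((hmeas w₀).mul (hmeas w₀)).neg.aestronglyMeasurable ?_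
    ((hν.const_mul _).const_mul _) ?_).2.differentiableAt
  · refine (hν.const_mul (2 / a + 1)).mono' (hmeas w₀).aestronglyMeasurable ?_
    refine ae_restrict_of_forall_mem measurableSet_Ioi fun r hr => ?_
    exact (norm_inv_add_sq_le ha (by linarith)).trans (inv_add_sq_le_mul_inv_one_add ha hr)
  · refine ae_restrict_of_forall_mem measurableSet_Ioi fun r hr w hw => ?_
    have h := norm_inv_add_sq_le (r := r) ha (le_of_lt hw)
    rw [norm_neg, norm_mul]
    refine mul_le_mul (h.trans (inv_anti₀ ha (by nlinarith [sq_nonneg r])))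
      (h.trans (inv_add_sq_le_mul_inv_one_add ha hr)) (norm_nonneg _) (by positivity)
  · refine Eventually.of_forall fun r w hw => ?_
    have hne := add_ofReal_sq_ne_zero (ha.trans hw) r
    have hd := ((hasDerivAt_id' w).add_const ((r : ℂ) ^ 2)).inv hne
    rwa [show -((w + (r : ℂ) ^ 2)⁻¹ * (w + (r : ℂ) ^ 2)⁻¹) = -1 / (w + (r : ℂ) ^ 2) ^ 2 by
      rw [← mul_inv, ← sq, neg_div, one_div]]

/-- Rigidity of power laws: if the attenuation function
`A₁(ω) = ω² ∫ (ω² + r²)⁻¹ ν(dr)` of a positive measure `ν` on `(0,∞)` with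
`∫ (1+r)⁻¹ ν(dr) < ∞` agrees with `C ω^γ` on a nonempty open interval contained in
`(0,∞)`, then `A₁(ω) = C ω^γ` for all `ω > 0`. -/
theorem power_law_rigidity (ν : Measure ℝ)
    (hν : IntegrableOn (fun r : ℝ => (1 + r)⁻¹) (Set.Ioi 0) ν)
    (A₁ : ℝ → ℝ)
    (hA : ∀ ω : ℝ, 0 < ω →
      A₁ ω = ω ^ 2 * ∫ r in Set.Ioi (0 : ℝ), (ω ^ 2 + r ^ 2)⁻¹ ∂ν)
    (C γ : ℝ) (hC : 0 < C)
    (I : Set ℝ) (hIopen : IsOpen I) (hIne : I.Nonempty) (hIsub : I ⊆ Set.Ioi 0)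
    (hfit : ∀ ω ∈ I, A₁ ω = C * ω ^ γ) :
    ∀ ω : ℝ, 0 < ω → A₁ ω = C * ω ^ γ := by
  let F : ℂ → ℂ := fun w => w * ∫ r in Set.Ioi (0 : ℝ), (w + (r : ℂ) ^ 2)⁻¹ ∂ν
  let G : ℂ → ℂ := fun w => (C : ℂ) * w ^ ((γ / 2 : ℝ) : ℂ)
  let U : Set ℂ := {w | 0 < w.re}
  have hU : IsOpen U := isOpen_lt continuous_const Complex.continuous_re
  have hF : AnalyticOnNhd ℂ F U := DifferentiableOn.analyticOnNhd (fun w hw =>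
    (differentiableAt_id.mul
      (differentiableAt_integral_inv_add_sq hν hw)).differentiableWithinAt) hU
  have hG : AnalyticOnNhd ℂ G U := DifferentiableOn.analyticOnNhd (fun w hw =>
    ((differentiableAt_id.cpow_const (Or.inl hw)).const_mul _).differentiableWithinAt) hU
  have hUconn : IsPreconnected U := (convex_halfSpace_re_gt 0).isPreconnected
  have hmem : ∀ ω : ℝ, 0 < ω → ((ω : ℂ) ^ 2) ∈ U := fun ω hω => by
    change 0 < ((ω : ℂ) ^ 2).re
    rw [← Complex.ofReal_pow, Complex.ofReal_re]
    positivity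
  have hFA : ∀ ω : ℝ, 0 < ω → F ((ω : ℂ) ^ 2) = (A₁ ω : ℂ) := fun ω hω => by
    rw [hA ω hω, Complex.ofReal_mul, ← integral_complex_ofReal]
    simp [F]
  have hGA : ∀ ω : ℝ, 0 < ω → G ((ω : ℂ) ^ 2) = ((C * ω ^ γ : ℝ) : ℂ) := fun ω hω => by
    simp only [G]
    rw [← Complex.ofReal_pow, ← Complex.ofReal_cpow (by positivity), ← Complex.ofReal_mul,
      ← Real.rpow_natCast, ← Real.rpow_mul hω.le]
    congr 3
    push_cast
    ring
  obtain ⟨ω₀, hω₀⟩ := hIne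
  have hω₀pos : 0 < ω₀ := hIsub hω₀
  have htend : Tendsto (fun ω : ℝ => (ω : ℂ) ^ 2) (𝓝[≠] ω₀) (𝓝[≠] ((ω₀ : ℂ) ^ 2)) := by
    refine tendsto_nhdsWithin_iff.2 ⟨?_, ?_⟩
    · exact (Continuous.tendsto (by fun_prop) ω₀).mono_left nhdsWithin_le_nhds
    · filter_upwards [self_mem_nhdsWithin, nhdsWithin_le_nhds (hIopen.mem_nhds hω₀)]
        with ω hne hωI heq
      have hsq : ω ^ 2 = ω₀ ^ 2 := by
        rw [Set.mem_singleton_iff] at heq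
        exact_mod_cast heq
      exact hne ((sq_eq_sq₀ (le_of_lt (hIsub hωI)) hω₀pos.le).1 hsq)
  have hfreq : ∃ᶠ w in 𝓝[≠] ((ω₀ : ℂ) ^ 2), F w = G w := by
    refine htend.frequently (Eventually.frequently ?_)
    filter_upwards [nhdsWithin_le_nhds (hIopen.mem_nhds hω₀)] with ω hωI
    rw [hFA ω (hIsub hωI), hGA ω (hIsub hωI), hfit ω hωI]
  have hEq := hF.eqOn_of_preconnected_of_frequently_eq hG hUconn (hmem ω₀ hω₀pos) hfreq
  intro ω hω
  have h := hEq (hmem ω hω)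
  rw [hFA ω hω, hGA ω hω] at h
  exact_mod_cast h
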